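/- arXiv:2211.15249 — 3 statements merged into one kernel-verified Lean document; each statement's English description precedes it below -/
import Mathlib

section
/- There exists a finitely generated group which is not weakly locally stable. -/
open Filter Topology

open scoped Classical

/-- Normalized Hamming metric on `Sym(k)`:
`d_k(σ,τ) = |{i : σ i ≠ τ i}| / k` (which equals `1 - |{i : σ i = τ i}|/k` for `k ≥ 1`). -/
noncomputable def dHam {k : ℕ} (σ τ : Equiv.Perm (Fin k)) : ℝ :=
  ((Finset.univ.filter fun i => σ i ≠ τ i).card : ℝ) / k

/-- `(φ_n)` is an almost-homomorphism. -/
def IsAlmostHom {Γ : Type*} [Group Γ] (k : ℕ → ℕ)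
    (φ : ∀ n, Γ → Equiv.Perm (Fin (k n))) : Prop :=
  ∀ g h : Γ,
    Tendsto (fun n => dHam (φ n g * φ n h) (φ n (g * h))) atTop (𝓝 0)

/-- `(φ_n)` is a partial homomorphism. -/
def IsPartialHom {Γ : Type*} [Group Γ] (k : ℕ → ℕ)
    (φ : ∀ n, Γ → Equiv.Perm (Fin (k n))) : Prop :=
  ∀ g h : Γ, ∀ᶠ n in atTop, φ n (g * h) = φ n g * φ n h

/-- `(φ_n)` is separating. -/
def IsSeparating {Γ : Type*} [Group Γ] (k : ℕ → ℕ)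
    (φ : ∀ n, Γ → Equiv.Perm (Fin (k n))) : Prop :=
  ∀ g : Γ, g ≠ 1 → Tendsto (fun n => dHam (φ n g) 1) atTop (𝓝 1)

/-- `(φ_n)` is a sequence of genuine homomorphisms. -/
def IsHomSeq {Γ : Type*} [Group Γ] (k : ℕ → ℕ)
    (φ : ∀ n, Γ → Equiv.Perm (Fin (k n))) : Prop :=
  ∀ n, ∀ g h : Γ, φ n (g * h) = φ n g * φ n h

/-- `(ψ_n)` is asymptotically close to `(φ_n)`: for every `g`, `d_{k_n}(φ_n g, ψ_n g) → 0`. -/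
def CloseSeq {Γ : Type*} [Group Γ] (k : ℕ → ℕ)
    (φ ψ : ∀ n, Γ → Equiv.Perm (Fin (k n))) : Prop :=
  ∀ g : Γ, Tendsto (fun n => dHam (φ n g) (ψ n g)) atTop (𝓝 0)

/-- `Γ` is locally stable. -/
def IsLocallyStable (Γ : Type*) [Group Γ] : Prop :=
  ∀ (k : ℕ → ℕ), (∀ n, 0 < k n) →
    ∀ φ : ∀ n, Γ → Equiv.Perm (Fin (k n)), IsAlmostHom k φ →
      ∃ ψ : ∀ n, Γ → Equiv.Perm (Fin (k n)), IsPartialHom k ψ ∧ CloseSeq k φ ψ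

/-- `Γ` is weakly locally stable. -/
def IsWeaklyLocallyStable (Γ : Type*) [Group Γ] : Prop :=
  ∀ (k : ℕ → ℕ), (∀ n, 0 < k n) →
    ∀ φ : ∀ n, Γ → Equiv.Perm (Fin (k n)), IsAlmostHom k φ → IsSeparating k φ →
      ∃ ψ : ∀ n, Γ → Equiv.Perm (Fin (k n)), IsPartialHom k ψ ∧ CloseSeq k φ ψ

/-- `Γ` is stable (in permutations). -/
def IsStable (Γ : Type*) [Group Γ] : Prop :=
  ∀ (k : ℕ → ℕ), (∀ n, 0 < k n) →
    ∀ φ : ∀ n, Γ → Equiv.Perm (Fin (k n)), IsAlmostHom k φ →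
      ∃ ψ : ∀ n, Γ → Equiv.Perm (Fin (k n)), IsHomSeq k ψ ∧ CloseSeq k φ ψ

/-- `Γ` is weakly stable. -/
def IsWeaklyStable (Γ : Type*) [Group Γ] : Prop :=
  ∀ (k : ℕ → ℕ), (∀ n, 0 < k n) →
    ∀ φ : ∀ n, Γ → Equiv.Perm (Fin (k n)), IsAlmostHom k φ → IsSeparating k φ →
      ∃ ψ : ∀ n, Γ → Equiv.Perm (Fin (k n)), IsHomSeq k ψ ∧ CloseSeq k φ ψ

/-- `Γ` is sofic: it admits a separating almost-homomorphism. -/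
def IsSofic (Γ : Type*) [Group Γ] : Prop :=
  ∃ (k : ℕ → ℕ), (∀ n, 0 < k n) ∧
    ∃ φ : ∀ n, Γ → Equiv.Perm (Fin (k n)), IsAlmostHom k φ ∧ IsSeparating k φ

/-- `Γ` is LEF: it admits a separating partial homomorphism. -/
def IsLEF (Γ : Type*) [Group Γ] : Prop :=
  ∃ (k : ℕ → ℕ), (∀ n, 0 < k n) ∧
    ∃ φ : ∀ n, Γ → Equiv.Perm (Fin (k n)), IsPartialHom k φ ∧ IsSeparating k φ

open Finset in
/-- The Følner condition: every finite subset of `Γ` moves some nonempty finite set only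
slightly. -/
def FolnerCondition (Γ : Type*) [Group Γ] : Prop :=
  ∀ (S : Finset Γ) (ε : ℝ), 0 < ε → ∃ F : Finset Γ, F.Nonempty ∧
    ∀ g ∈ S, (#{x ∈ F | g * x ∉ F} : ℝ) ≤ ε * #F

section Sofic

open Finset

lemma card_filter_equivFin_symm {α : Type*} (F : Finset α) (p : α → Prop) [DecidablePred p] :
    #{i : Fin #F | p (F.equivFin.symm i)} = #{x ∈ F | p x} := by
  refine Finset.card_bij (fun i _ => (F.equivFin.symm i : α)) ?_ ?_ ?_
  · intro i hi
    simpa using hi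
  · intro i _ j _ hij
    exact F.equivFin.symm.injective (Subtype.ext hij)
  · intro x hx
    rw [Finset.mem_filter] at hx
    exact ⟨F.equivFin ⟨x, hx.1⟩, by simpa using hx.2, by simp⟩

variable {Γ : Type*} [Group Γ]

/-- Left translations of a finite subset of a group can be completed to permutations. -/
lemma exists_perm_extending_mul_left (F : Finset Γ) :
    ∃ φ : Γ → Equiv.Perm F, ∀ (g : Γ) (x : F), g * (x : Γ) ∈ F → (φ g x : Γ) = g * (x : Γ) := by
  have h (g : Γ) : ∃ e : Equiv.Perm F, ∀ x : F, g * x ∈ F → (e x : Γ) = g * x := by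
    obtain ⟨e, he⟩ := Set.MapsTo.exists_equiv_extend_of_card_eq (α := F) (t := F)
      (by simp) (s := {x : F | g * x ∈ F}) (f := fun x : F => g * x)
      (fun x hx => hx) (fun x _ y _ hxy => Subtype.ext (mul_left_cancel hxy))
    exact ⟨e, fun x hx => he x hx⟩
  choose φ hφ using h
  exact ⟨φ, hφ⟩

lemma exists_approx_action (F : Finset Γ) (hF : F.Nonempty) :
    ∃ φ : Γ → Equiv.Perm (Fin #F),
      (∀ g h, dHam (φ g * φ h) (φ (g * h)) ≤
        (#{x ∈ F | h * x ∉ F} : ℝ) / #F + (#{x ∈ F | g * h * x ∉ F} : ℝ) / #F) ∧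
      ∀ g, g ≠ 1 → 1 - (#{x ∈ F | g * x ∉ F} : ℝ) / #F ≤ dHam (φ g) 1 := by
  obtain ⟨φ, hφ⟩ := exists_perm_extending_mul_left F
  have hpos : (0 : ℝ) < #F := by exact_mod_cast hF.card_pos
  refine ⟨fun g => F.equivFin.permCongr (φ g), fun g h => ?_, fun g hg => ?_⟩
  · unfold dHam
    rw [← add_div]
    gcongr
    rw [← card_filter_equivFin_symm F (fun x => h * x ∉ F),
      ← card_filter_equivFin_symm F (fun x => g * h * x ∉ F)]
    norm_cast
    refine le_trans (card_le_card ?_) (card_union_le _ _)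
    intro i hi
    simp only [mem_filter, mem_union, mem_univ, true_and] at hi ⊢
    by_contra! hcon
    apply hi
    have h1 := hφ h _ hcon.1
    have h2 := hφ (g * h) _ hcon.2
    have h3 := hφ g (φ h (F.equivFin.symm i)) (by rw [h1, ← mul_assoc]; exact hcon.2)
    simp only [Equiv.Perm.coe_mul, Function.comp_apply, Equiv.permCongr_apply,
      Equiv.symm_apply_apply]
    congr 1
    apply Subtype.ext
    rw [h2, h3, h1, mul_assoc]
  · unfold dHam
    rw [one_sub_div hpos.ne']
    gcongr
    rw [sub_le_iff_le_add, ← card_filter_equivFin_symm F (fun x => g * x ∉ F)]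
    norm_cast
    refine le_trans ?_ (card_union_le _ _)
    conv_lhs => rw [← Fintype.card_fin #F]
    refine card_le_card ?_
    intro i _
    simp only [mem_filter, mem_union, mem_univ, true_and]
    by_contra! hcon
    have h1 := hφ g _ hcon.2
    have h2 : φ g (F.equivFin.symm i) = F.equivFin.symm i := by
      rw [← Equiv.apply_eq_iff_eq F.equivFin]
      by_contra hne
      refine hcon.1 (mem_filter.2 ⟨mem_univ i, ?_⟩)
      simpa [Equiv.permCongr_apply] using hne
    rw [h2] at h1
    exact hg (by simpa using h1.symm)

lemma dHam_nonneg {k : ℕ} (σ τ : Equiv.Perm (Fin k)) : 0 ≤ dHam σ τ := by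
  unfold dHam
  positivity

lemma dHam_le_one {k : ℕ} (σ τ : Equiv.Perm (Fin k)) : dHam σ τ ≤ 1 := by
  unfold dHam
  refine div_le_one_of_le₀ ?_ (by positivity)
  exact_mod_cast (card_filter_le _ _).trans (by simp)

lemma dHam_self {k : ℕ} (σ : Equiv.Perm (Fin k)) : dHam σ σ = 0 := by
  simp [dHam]

lemma FolnerCondition.isSofic [Countable Γ] (hΓ : FolnerCondition Γ) : IsSofic Γ := by
  obtain ⟨f, hf⟩ := exists_injective_nat Γ
  have hS (n : ℕ) : {g : Γ | f g ≤ n}.Finite :=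
    Set.Finite.preimage hf.injOn (Set.finite_Iic n)
  choose F hF hFS using fun n : ℕ =>
    hΓ (hS n).toFinset (1 / ((n : ℝ) + 1)) (by positivity)
  choose φ hmul hsep using fun n => exists_approx_action (F n) (hF n)
  have hlim (g : Γ) :
      Tendsto (fun n => (#{x ∈ F n | g * x ∉ F n} : ℝ) / #(F n)) atTop (𝓝 0) := by
    refine squeeze_zero' (Eventually.of_forall fun n => by positivity) ?_
      tendsto_one_div_add_atTop_nhds_zero_nat
    filter_upwards [eventually_ge_atTop (f g)] with n hn
    have hpos : (0 : ℝ) < #(F n) := by exact_mod_cast (hF n).card_pos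
    rw [div_le_iff₀ hpos]
    exact hFS n g (by simpa using hn)
  refine ⟨fun n => #(F n), fun n => (hF n).card_pos, φ, fun g h => ?_, fun g hg => ?_⟩
  · exact squeeze_zero (fun n => dHam_nonneg _ _) (fun n => hmul n g h)
      (by simpa using (hlim h).add (hlim (g * h)))
  · exact tendsto_of_tendsto_of_tendsto_of_le_of_le (by simpa using (hlim g).const_sub 1)
      tendsto_const_nhds (fun n => hsep n g hg) (fun n => dHam_le_one _ _)

end Sofic

section Folner

open Finset

lemma folnerCondition_multiplicative_int : FolnerCondition (Multiplicative ℤ) := by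
  intro S ε hε
  obtain ⟨n, hn⟩ := exists_nat_gt ((∑ g ∈ S, (g.toAdd.natAbs : ℝ)) / ε)
  have hn0 : (0 : ℝ) < n := lt_of_le_of_lt (by positivity) hn
  have hcard : #((Ico (0 : ℤ) n).map Multiplicative.ofAdd.toEmbedding) = n := by simp
  refine ⟨(Ico (0 : ℤ) n).map Multiplicative.ofAdd.toEmbedding, ?_, fun g hg => ?_⟩
  · rw [← card_pos, hcard]
    exact_mod_cast hn0
  · rw [hcard]
    have hle : (g.toAdd.natAbs : ℝ) ≤ ε * n := by
      rw [div_lt_iff₀ hε] at hn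
      have := single_le_sum (f := fun g : Multiplicative ℤ => (g.toAdd.natAbs : ℝ))
        (fun _ _ => by positivity) hg
      linarith
    refine le_trans ?_ hle
    norm_cast
    have hsub : #(if 0 ≤ g.toAdd then Ico ((n : ℤ) - g.toAdd) n else Ico 0 (-g.toAdd)) =
        g.toAdd.natAbs := by
      split_ifs <;> simp <;> omega
    rw [← hsub, ← card_map (Multiplicative.ofAdd (α := ℤ)).toEmbedding]
    refine card_le_card fun x hx => ?_
    obtain ⟨x, rfl⟩ := Multiplicative.ofAdd.surjective x
    obtain ⟨g, rfl⟩ := Multiplicative.ofAdd.surjective g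
    simp only [mem_filter, ← ofAdd_add, mem_map_equiv, Multiplicative.ofAdd_symm_eq, toAdd_ofAdd,
      mem_Ico] at hx ⊢
    split_ifs <;> simp only [mem_Ico] <;> omega

lemma FolnerCondition.prod {G H : Type*} [Group G] [Group H] (hG : FolnerCondition G)
    (hH : FolnerCondition H) : FolnerCondition (G × H) := by
  intro S ε hε
  obtain ⟨E, hE, hES⟩ := hG (S.image Prod.fst) (ε / 2) (by positivity)
  obtain ⟨F, hF, hFS⟩ := hH (S.image Prod.snd) (ε / 2) (by positivity)
  refine ⟨E ×ˢ F, hE.product hF, fun g hg => ?_⟩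
  have h1 := hES g.1 (mem_image_of_mem _ hg)
  have h2 := hFS g.2 (mem_image_of_mem _ hg)
  calc _ ≤ (#({x ∈ E | g.1 * x ∉ E} ×ˢ F ∪ E ×ˢ {y ∈ F | g.2 * y ∉ F}) : ℝ) := by
        refine Nat.cast_le.2 (card_le_card fun x hx => ?_)
        simp only [mem_filter, mem_product, mem_union, Prod.fst_mul, Prod.snd_mul] at hx ⊢
        tauto
    _ ≤ (#{x ∈ E | g.1 * x ∉ E} * #F + #E * #{y ∈ F | g.2 * y ∉ F} : ℝ) := by
        rw [← Nat.cast_mul, ← Nat.cast_mul, ← card_product, ← card_product]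
        exact_mod_cast card_union_le _ _
    _ ≤ ε / 2 * #E * #F + #E * (ε / 2 * #F) := by gcongr
    _ = ε * #(E ×ˢ F) := by rw [card_product]; push_cast; ring

/-- The Følner condition passes to extensions by locally finite kernels. -/
lemma FolnerCondition.of_surjective {G Q : Type*} [Group G] [Group Q] (hQ : FolnerCondition Q)
    (π : G →* Q) (hπ : Function.Surjective π)
    (hker : ∀ T : Finset G, (∀ g ∈ T, π g = 1) → ∃ K : Finset G, K.Nonempty ∧
      (∀ k ∈ K, π k = 1) ∧ ∀ g ∈ T, ∀ k ∈ K, g * k ∈ K) : FolnerCondition G := by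
  intro S ε hε
  obtain ⟨E, hE, hES⟩ := hQ (S.image π) ε hε
  obtain ⟨σ, hσ⟩ := hπ.hasRightInverse
  obtain ⟨K, hK, hK1, hKT⟩ := hker
    ((S ×ˢ E).image fun p => (σ (π p.1 * p.2))⁻¹ * (p.1 * σ p.2)) (by
      simp only [mem_image, forall_exists_index, and_imp]
      rintro _ p - rfl
      simp [hσ _])
  have hinj : Set.InjOn (fun p : Q × G => σ p.1 * p.2) {p | p.2 ∈ K} := by
    rintro ⟨v, k⟩ hk ⟨w, l⟩ hl heq
    have hvw : v = w := by
      simpa [hσ _, hK1 k hk, hK1 l hl] using congrArg π heq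
    subst hvw
    simpa using heq
  have hcard (A : Finset Q) : #((A ×ˢ K).image fun p => σ p.1 * p.2) = #A * #K := by
    rw [card_image_of_injOn (hinj.mono fun p hp => ?_), card_product]
    exact (mem_product.1 hp).2
  refine ⟨(E ×ˢ K).image fun p => σ p.1 * p.2, (hE.product hK).image _, fun g hg => ?_⟩
  have hsub : {x ∈ (E ×ˢ K).image fun p => σ p.1 * p.2 |
      g * x ∉ (E ×ˢ K).image fun p => σ p.1 * p.2} ⊆
      ({v ∈ E | π g * v ∉ E} ×ˢ K).image fun p => σ p.1 * p.2 := by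
    intro x hx
    rw [mem_filter, mem_image] at hx
    obtain ⟨⟨⟨v, k⟩, hvk, rfl⟩, hx⟩ := hx
    rw [mem_product] at hvk
    refine mem_image.2 ⟨(v, k), mem_product.2 ⟨mem_filter.2 ⟨hvk.1, fun hv => hx ?_⟩, hvk.2⟩, rfl⟩
    refine mem_image.2 ⟨(π g * v, (σ (π g * v))⁻¹ * (g * σ v) * k), mem_product.2 ⟨hv, ?_⟩, ?_⟩
    · exact hKT _ (mem_image.2 ⟨(g, v), mem_product.2 ⟨hg, hvk.1⟩, rfl⟩) _ hvk.2
    · simp [mul_assoc]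
  have h1 := card_le_card hsub
  rw [hcard] at h1
  have h2 := hES (π g) (mem_image_of_mem _ hg)
  calc _ ≤ (#{v ∈ E | π g * v ∉ E} : ℝ) * #K := by exact_mod_cast h1
    _ ≤ ε * #E * #K := by gcongr
    _ = _ := by rw [hcard]; push_cast; ring

end Folner

section FiniteGroups

/-- In a finite group, if conjugation by `t` maps `⟨a, s⟩` into itself, then it does so
surjectively; hence whatever commutes with `t * a * t⁻¹` and `t * s * t⁻¹` commutes with `s`. -/
lemma commute_of_finite {G : Type*} [Group G] [Finite G] {a s t c u : G}
    (hta : t * a = s * a * t) (hut : u * t = t * s) (hua : u * a = a * s)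
    (hc : Commute c (s * a)) (hcu : Commute c u) : Commute c s := by
  let H := Subgroup.closure {a, s}
  have ha : a ∈ H := Subgroup.subset_closure (by simp)
  have hs : s ∈ H := Subgroup.subset_closure (by simp)
  have hmapa : t * a * t⁻¹ = s * a := by rw [hta]; group
  have hmaps : t * s * t⁻¹ = u := by rw [← hut]; group
  have hu : u ∈ H := by
    rw [eq_mul_inv_of_mul_eq hua]
    exact H.mul_mem (H.mul_mem ha hs) (H.inv_mem ha)
  have hmap (L : Subgroup G) (h1 : s * a ∈ L) (h2 : u ∈ L) :
      H.map (MulAut.conj t).toMonoidHom ≤ L := by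
    rw [MonoidHom.map_closure, Subgroup.closure_le]
    rintro _ ⟨x, rfl | rfl, rfl⟩
    · simpa [hmapa] using h1
    · simpa [hmaps] using h2
  have heq : H.map (MulAut.conj t).toMonoidHom = H :=
    Subgroup.eq_of_le_of_card_ge (hmap H (H.mul_mem hs ha) hu)
      (Subgroup.card_map_of_injective (MulAut.conj t).injective).ge
  have hle := hmap (Subgroup.centralizer {c})
    (Subgroup.mem_centralizer_singleton_iff.2 hc.symm)
    (Subgroup.mem_centralizer_singleton_iff.2 hcu.symm)
  rw [heq] at hle
  exact (Subgroup.mem_centralizer_singleton_iff.1 (hle hs)).symm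

lemma not_isWeaklyLocallyStable_of_isSofic {Γ : Type*} [Group Γ] (hΓ : IsSofic Γ)
    {a s t c u : Γ} (hta : t * a = s * a * t) (hut : u * t = t * s) (hua : u * a = a * s)
    (hc : Commute c (s * a)) (hcu : Commute c u) (hcs : ¬ Commute c s) :
    ¬ IsWeaklyLocallyStable Γ := by
  intro hst
  obtain ⟨k, hk, φ, hφ, hsep⟩ := hΓ
  obtain ⟨ψ, hψ, hclose⟩ := hst k hk φ hφ hsep
  have hw : c * s * (s * c)⁻¹ ≠ 1 := fun h => hcs (mul_inv_eq_one.1 h)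
  have hone : ∀ᶠ n in atTop, ψ n (c * s * (s * c)⁻¹) = 1 := by
    filter_upwards [hψ t a, hψ (s * a) t, hψ s a, hψ u t, hψ t s, hψ u a, hψ a s,
      hψ c (s * a), hψ (s * a) c, hψ c u, hψ u c, hψ c s, hψ s c,
      hψ (c * s * (s * c)⁻¹) (s * c)] with n h1 h2 h3 h4 h5 h6 h7 h8 h9 h10 h11 h12 h13 h14
    have key : Commute (ψ n c) (ψ n s) :=
      commute_of_finite (a := ψ n a) (t := ψ n t) (u := ψ n u)
        (by rw [← h1, ← h3, ← h2, hta]) (by rw [← h4, ← h5, hut])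
        (by rw [← h6, ← h7, hua])
        (by rw [Commute, SemiconjBy, ← h3, ← h8, ← h9, hc.eq])
        (by rw [Commute, SemiconjBy, ← h10, ← h11, hcu.eq])
    rw [inv_mul_cancel_right, h12, h13, key.eq] at h14
    exact right_eq_mul.1 h14
  refine zero_ne_one (tendsto_nhds_unique (hclose (c * s * (s * c)⁻¹)) ((hsep _ hw).congr' ?_))
  filter_upwards [hone] with n hn
  rw [hn]

end FiniteGroups

section Houghton

/-- The normal subgroup of permutations that move only finitely many points. -/
def finitaryPerm (X : Type*) : Subgroup (Equiv.Perm X) where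
  carrier := {g | {x | g x ≠ x}.Finite}
  one_mem' := by simp
  mul_mem' {g h} hg hh := by
    refine (Set.Finite.union hg hh).subset fun x hx => ?_
    by_contra hcon
    simp only [Set.mem_union, Set.mem_ofPred_eq, not_or, not_not] at hcon
    exact hx (by simp [hcon.1, hcon.2])
  inv_mem' {g} hg := by
    refine Set.Finite.subset hg fun x hx hgx => hx ?_
    rw [Equiv.Perm.inv_eq_iff_eq, hgx]

lemma mem_finitaryPerm {X : Type*} {g : Equiv.Perm X} :
    g ∈ finitaryPerm X ↔ {x | g x ≠ x}.Finite := Iff.rfl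

instance (X : Type*) : (finitaryPerm X).Normal where
  conj_mem g hg h := by
    refine (Set.Finite.image h hg).subset fun x hx => ⟨h⁻¹ x, fun hgx => hx ?_, by simp⟩
    simp only [Equiv.Perm.mul_apply, hgx]
    exact h.apply_symm_apply x

lemma swap_mem_finitaryPerm {X : Type*} [DecidableEq X] (x y : X) : Equiv.swap x y ∈ finitaryPerm X := by
  refine (Set.toFinite {x, y}).subset fun z hz => ?_
  by_contra hcon
  simp only [Set.mem_insert_iff, Set.mem_singleton_iff, not_or] at hcon
  exact hz (Equiv.swap_apply_of_ne_of_ne hcon.1 hcon.2)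

/-- The shift of the line `ℤ`, fixing the additional ray `ℕ`. -/
def lineShift : Equiv.Perm (ℤ ⊕ ℕ) := Equiv.sumCongr (Equiv.addRight 1) (Equiv.refl ℕ)

/-- The shift from the additional ray `ℕ` into the nonnegative half of the line `ℤ`. -/
def rayShift : Equiv.Perm (ℤ ⊕ ℕ) where
  toFun
    | .inl n => if 0 ≤ n then .inl (n + 1) else .inl n
    | .inr 0 => .inl 0
    | .inr (k + 1) => .inr k
  invFun
    | .inl n => if 0 < n then .inl (n - 1) else if n = 0 then .inr 0 else .inl n
    | .inr k => .inr (k + 1)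
  left_inv := by
    rintro (n | _ | k)
    · grind
    · simp
    · simp
  right_inv := by
    rintro (n | k)
    · grind
    · simp

@[simp] lemma lineShift_inl (n : ℤ) : lineShift (.inl n) = .inl (n + 1) := rfl

@[simp] lemma lineShift_inr (k : ℕ) : lineShift (.inr k) = .inr k := rfl

lemma rayShift_inl (n : ℤ) :
    rayShift (.inl n) = if 0 ≤ n then .inl (n + 1) else .inl n := rfl

@[simp] lemma rayShift_inr_zero : rayShift (.inr 0) = .inl 0 := rfl

@[simp] lemma rayShift_inr_succ (k : ℕ) : rayShift (.inr (k + 1)) = .inr k := rfl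

lemma rayShift_mul_lineShift :
    rayShift * lineShift = Equiv.swap (.inl 0) (.inl 1) * lineShift * rayShift := by
  ext1 x
  rcases x with n | _ | k
  · simp only [Equiv.Perm.mul_apply, lineShift_inl, rayShift_inl, Equiv.swap_apply_def]
    split_ifs <;> grind [lineShift_inl]
  · simp
  · simp [Equiv.swap_apply_def]

lemma Equiv.Perm.mul_swap_eq {X : Type*} [DecidableEq X] (f : Equiv.Perm X) (x y : X) :
    f * Equiv.swap x y = Equiv.swap (f x) (f y) * f := by
  rw [Equiv.swap_apply_apply, inv_mul_cancel_right]

/-- Houghton's group on three rays, generated by the two shifts; the second factor records the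
exponent sums of the two generators. -/
def shiftGroup :
    Subgroup (Equiv.Perm (ℤ ⊕ ℕ) × (Multiplicative ℤ × Multiplicative ℤ)) :=
  Subgroup.closure
    {(lineShift, (Multiplicative.ofAdd 1, 1)), (rayShift, (1, Multiplicative.ofAdd 1))}

instance : Group.FG shiftGroup :=
  (Group.fg_iff_subgroup_fg _).2 ⟨_, by rw [Finset.coe_pair]; rfl⟩

instance : Countable shiftGroup := by
  obtain ⟨S, hS, f, hf⟩ :=
    Group.fg_iff_exists_freeGroup_hom_surjective_finite.1 (inferInstance : Group.FG shiftGroup)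
  exact hf.countable

lemma mem_finitaryPerm_of_mem_shiftGroup {g : Equiv.Perm (ℤ ⊕ ℕ)}
    (hg : (g, 1) ∈ shiftGroup) : g ∈ finitaryPerm (ℤ ⊕ ℕ) := by
  let q := QuotientGroup.mk' (finitaryPerm (ℤ ⊕ ℕ))
  have hcomm : Commute (q lineShift) (q rayShift) := by
    have hs : q (Equiv.swap (.inl 0) (.inl 1)) = 1 :=
      (QuotientGroup.eq_one_iff _).2 (swap_mem_finitaryPerm _ _)
    have := congrArg q rayShift_mul_lineShift
    rw [map_mul, map_mul, map_mul, hs, one_mul] at this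
    exact this.symm
  let ρ := MonoidHom.noncommCoprod (zpowersHom _ (q lineShift)) (zpowersHom _ (q rayShift))
    fun m n => by simpa using hcomm.zpow_zpow _ _
  have hle : shiftGroup ≤ (q.comp (MonoidHom.fst _ _)).eqLocus (ρ.comp (MonoidHom.snd _ _)) := by
    refine (Subgroup.closure_le _).2 ?_
    rintro _ (rfl | rfl)
    · change q lineShift = ρ (Multiplicative.ofAdd 1, 1)
      simp [ρ]
    · change q rayShift = ρ (1, Multiplicative.ofAdd 1)
      simp [ρ]
  have h1 : q g = ρ 1 := hle hg
  rw [map_one] at h1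
  exact (QuotientGroup.eq_one_iff _).1 h1

lemma finite_setOf_perm_fixing_compl {X : Type*} {B : Set X} (hB : B.Finite) :
    {g : Equiv.Perm X | ∀ x, x ∉ B → g x = x}.Finite := by
  have := hB.to_subtype
  exact Set.finite_coe_iff.1 (Finite.of_equiv _ (Equiv.Perm.subtypeEquivSubtypePerm (· ∈ B)))

lemma folnerCondition_shiftGroup : FolnerCondition shiftGroup := by
  refine (folnerCondition_multiplicative_int.prod folnerCondition_multiplicative_int).of_surjective
    ((MonoidHom.snd _ _).comp shiftGroup.subtype) ?_ fun T hT => ?_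
  · rintro ⟨m, n⟩
    refine ⟨⟨_, Subgroup.subset_closure (Set.mem_insert _ _)⟩ ^ m.toAdd *
      ⟨_, Subgroup.subset_closure (Set.mem_insert_of_mem _ rfl)⟩ ^ n.toAdd, ?_⟩
    rw [map_mul, map_zpow, map_zpow]
    ext <;> simp [← ofAdd_zsmul]
  · let B : Set (ℤ ⊕ ℕ) := ⋃ g ∈ T, {x | g.1.1 x ≠ x}
    have hB : B.Finite := T.finite_toSet.biUnion fun g hg =>
      mem_finitaryPerm.1 (mem_finitaryPerm_of_mem_shiftGroup (by
        have h1 : g.1.2 = 1 := hT g hg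
        rw [← h1]
        exact g.2))
    have hfin : {k : shiftGroup | k.1.2 = 1 ∧ ∀ x, x ∉ B → k.1.1 x = x}.Finite := by
      refine Set.Finite.of_finite_image (f := fun k => k.1.1)
        ((finite_setOf_perm_fixing_compl hB).subset ?_) ?_
      · rintro _ ⟨k, hk, rfl⟩
        exact hk.2
      · intro k hk l hl hkl
        exact Subtype.ext (Prod.ext hkl (hk.1.trans hl.1.symm))
    refine ⟨hfin.toFinset, ⟨1, by simp⟩, fun k hk => ?_, fun g hg k hk => ?_⟩
    · rw [Set.Finite.mem_toFinset] at hk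
      exact hk.1
    · rw [Set.Finite.mem_toFinset] at hk ⊢
      have h1 : g.1.2 = 1 := hT g hg
      refine ⟨by simp [h1, hk.1], fun x hx => ?_⟩
      have hgx : g.1.1 x = x := by
        by_contra hne
        exact hx (Set.mem_biUnion hg hne)
      simp [hk.2 x hx, hgx]

lemma not_isWeaklyLocallyStable_shiftGroup : ¬ IsWeaklyLocallyStable shiftGroup := by
  let a : shiftGroup := ⟨_, Subgroup.subset_closure (Set.mem_insert _ _)⟩
  let t : shiftGroup := ⟨_, Subgroup.subset_closure (Set.mem_insert_of_mem _ rfl)⟩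
  have ha : a.1.1 = lineShift := rfl
  have ht : t.1.1 = rayShift := rfl
  let s := t * a * t⁻¹ * a⁻¹
  let c := t⁻¹ * s * t
  let u := t * s * t⁻¹
  have hs : s.1.1 = Equiv.swap (.inl 0) (.inl 1) := by
    simp [s, ha, ht, rayShift_mul_lineShift]
  have hc : c.1.1 = Equiv.swap (.inr 0) (.inl 0) := by
    have h := Equiv.Perm.mul_swap_eq rayShift (.inr 0) (.inl 0)
    simp only [c, Subgroup.coe_mul, Prod.fst_mul, hs, ht]
    change rayShift⁻¹ * _ * rayShift = _
    rw [mul_assoc, inv_mul_eq_iff_eq_mul, h]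
    simp [rayShift_inl]
  have hu : u.1.1 = Equiv.swap (.inl 1) (.inl 2) := by
    have h := Equiv.Perm.mul_swap_eq rayShift (.inl 0) (.inl 1)
    simp only [u, Subgroup.coe_mul, Prod.fst_mul, hs, ht]
    change rayShift * _ * rayShift⁻¹ = _
    rw [h]
    simp [rayShift_inl]
  have hs2 : s.1.2 = 1 := by simp [s]
  have hc2 : c.1.2 = 1 := by simp [c, hs2]
  have hu2 : u.1.2 = 1 := by simp [u, hs2]
  have hext {g h : shiftGroup} (h1 : g.1.1 = h.1.1) (h2 : g.1.2 = h.1.2) : g = h :=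
    Subtype.ext (Prod.ext h1 h2)
  refine not_isWeaklyLocallyStable_of_isSofic folnerCondition_shiftGroup.isSofic
    (a := a) (s := s) (t := t) (c := c) (u := u) ?_ ?_ ?_ ?_ ?_ ?_
  · simp [s]
  · simp [u]
  · refine hext ?_ (by simp [hs2, hu2])
    have h := Equiv.Perm.mul_swap_eq lineShift (.inl 0) (.inl 1)
    simpa [hs, hu, ha] using h.symm
  · refine hext ?_ (by simp [hs2, hc2])
    have h := Equiv.Perm.mul_swap_eq (Equiv.swap (.inl 0) (.inl 1) * lineShift)
      (.inr 0) (.inl 0)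
    simpa [hc, hs, ha, Equiv.swap_apply_of_ne_of_ne] using h.symm
  · refine hext ?_ (by simp [hu2, hc2])
    have h := Equiv.Perm.mul_swap_eq (Equiv.swap (.inl 1) (.inl 2)) (.inr 0)
      (.inl (0 : ℤ) : ℤ ⊕ ℕ)
    simpa [hc, hu, Equiv.swap_apply_of_ne_of_ne] using h.symm
  · intro h
    have h1 := DFunLike.congr_fun (congrArg (fun g : shiftGroup => g.1.1) h.eq) (.inr 0)
    simp [hc, hs, Equiv.swap_apply_def] at h1

end Houghton

/-- There is a finitely generated group which is not weakly locally stable. -/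
theorem exists_fg_not_weaklyLocallyStable :
    ∃ (Γ : Type) (_ : Group Γ), Group.FG Γ ∧ ¬ IsWeaklyLocallyStable Γ := by
  exact ⟨shiftGroup, inferInstance, inferInstance, not_isWeaklyLocallyStable_shiftGroup⟩
end

section
/- Let t ∈ Sym(ℤ) be the translation n ↦ n + 1. The subgroup of Sym(ℤ) generated by t together with all 3-cycles of elements of ℤ is equal to the subgroup generated by the two elements t and the single 3-cycle c = (−1 0 1); in particular, the alternating enrichment 𝒜(ℤ) = FAlt(ℤ) ⋊ ℤ is generated by two elements. -/
/-- The translation `n ↦ n + 1` as a permutation of `ℤ`. -/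
def translation : Equiv.Perm ℤ := Equiv.addRight 1

/-- The 3-cycle `(a b c)` (sending `a ↦ b ↦ c ↦ a`) as a permutation of `ℤ`. -/
def threeCycle (a b c : ℤ) : Equiv.Perm ℤ := Equiv.swap a c * Equiv.swap a b

theorem threeCycle_inv (a b c : ℤ) : (threeCycle a b c)⁻¹ = threeCycle a c b := by
  simp [threeCycle]

theorem threeCycle_rotate {a b c : ℤ} (hab : a ≠ b) (hac : a ≠ c) (hbc : b ≠ c) :
    threeCycle b c a = threeCycle a b c := by
  ext x
  simp only [threeCycle, Equiv.Perm.mul_apply, Equiv.swap_apply_def]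
  grind

theorem conj_threeCycle (σ : Equiv.Perm ℤ) (a b c : ℤ) :
    σ * threeCycle a b c * σ⁻¹ = threeCycle (σ a) (σ b) (σ c) := by
  simp only [threeCycle, Equiv.swap_apply_apply]
  group

section

variable {H : Subgroup (Equiv.Perm ℤ)}

theorem threeCycle_mem_swap {a b c : ℤ} (h : threeCycle a b c ∈ H) : threeCycle a c b ∈ H :=
  threeCycle_inv a b c ▸ H.inv_mem h

theorem threeCycle_mem_rotate {a b c : ℤ} (hab : a ≠ b) (hac : a ≠ c) (hbc : b ≠ c)
    (h : threeCycle a b c ∈ H) : threeCycle b c a ∈ H :=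
  (threeCycle_rotate hab hac hbc).symm ▸ h

/-- Two 3-cycles whose supports share the points `b` and `c` generate the 3-cycle obtained by
moving `a`, `b`, `c` along the second one. -/
theorem threeCycle_mem_of_overlap {a b c d : ℤ} (hab : a ≠ b) (hac : a ≠ c) (had : a ≠ d)
    (hbc : b ≠ c) (hcd : c ≠ d)
    (h₁ : threeCycle a b c ∈ H) (h₂ : threeCycle b c d ∈ H) : threeCycle a c d ∈ H := by
  have h := H.mul_mem (H.mul_mem h₂ h₁) (H.inv_mem h₂)
  rw [conj_threeCycle] at h
  have ha : threeCycle b c d a = a := by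
    simp only [threeCycle, Equiv.Perm.mul_apply, Equiv.swap_apply_def]
    grind
  have hb : threeCycle b c d b = c := by
    simp only [threeCycle, Equiv.Perm.mul_apply, Equiv.swap_apply_def]
    grind
  have hc : threeCycle b c d c = d := by
    simp only [threeCycle, Equiv.Perm.mul_apply, Equiv.swap_apply_def]
    grind
  rwa [ha, hb, hc] at h

theorem threeCycle_consecutive_mem (ht : translation ∈ H) (hc : threeCycle (-1) 0 1 ∈ H) (n : ℤ) :
    threeCycle n (n + 1) (n + 2) ∈ H := by
  have h := H.mul_mem (H.mul_mem (H.zpow_mem ht (n + 1)) hc) (H.inv_mem (H.zpow_mem ht (n + 1)))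
  rw [conj_threeCycle] at h
  have key (x : ℤ) : (translation ^ (n + 1)) x = x + (n + 1) := by
    simp [translation, add_assoc]
  simp only [key] at h
  convert h using 2 <;> ring

theorem threeCycle_adjacent_mem (h : ∀ n : ℤ, threeCycle n (n + 1) (n + 2) ∈ H) (k : ℕ) (n : ℤ) :
    threeCycle n (n + 1) (n + 2 + k) ∈ H := by
  induction k generalizing n with
  | zero => simpa using h n
  | succ k ih =>
    have h₁ := threeCycle_mem_swap (h n)
    have h₂ : threeCycle (n + 1) (n + 2) (n + 2 + (k + 1 : ℕ)) ∈ H := by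
      convert ih (n + 1) using 2 <;> push_cast <;> ring
    have h₃ := threeCycle_mem_rotate (by omega) (by omega) (by omega) (threeCycle_mem_swap h₂)
    have h₄ := threeCycle_mem_rotate (by omega) (by omega) (by omega) h₃
    exact threeCycle_mem_of_overlap (by omega) (by omega) (by omega) (by omega)
      (by omega) h₁ h₄

theorem threeCycle_mem_of_lt (h : ∀ n : ℤ, threeCycle n (n + 1) (n + 2) ∈ H) {a b c : ℤ}
    (hab : a < b) (hbc : b < c) : threeCycle a b c ∈ H := by
  obtain ⟨k, rfl⟩ : ∃ k : ℕ, b = a + 1 + k := ⟨(b - a - 1).toNat, by omega⟩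
  have adj (a : ℤ) (hac : a + 1 < c) : threeCycle a (a + 1) c ∈ H := by
    convert threeCycle_adjacent_mem h (c - a - 2).toNat a using 2
    omega
  induction k generalizing a with
  | zero => simpa using adj a (by omega)
  | succ k ih =>
    have h₂ : threeCycle (a + 1) (a + 1 + (k + 1 : ℕ)) c ∈ H := by
      have := ih (a := a + 1) (by omega) (by omega)
      convert this using 2
      push_cast
      ring
    exact threeCycle_mem_swap (threeCycle_mem_of_overlap (by omega) (by omega) (by omega)
      (by omega) (by omega) (adj a (by omega)) (threeCycle_mem_swap h₂))

theorem threeCycle_mem (h : ∀ n : ℤ, threeCycle n (n + 1) (n + 2) ∈ H) {a b c : ℤ}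
    (hab : a ≠ b) (hac : a ≠ c) (hbc : b ≠ c) : threeCycle a b c ∈ H := by
  have min_first {a b c : ℤ} (hab : a < b) (hac : a < c) (hbc : b ≠ c) :
      threeCycle a b c ∈ H := by
    rcases hbc.lt_or_gt with hlt | hlt
    · exact threeCycle_mem_of_lt h hab hlt
    · exact threeCycle_mem_swap (threeCycle_mem_of_lt h hac hlt)
  by_cases ha : a < b ∧ a < c
  · exact min_first ha.1 ha.2 hbc
  by_cases hb : b < a ∧ b < c
  · rw [← threeCycle_rotate hab hac hbc]
    exact min_first hb.2 hb.1 hac.symm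
  · rw [threeCycle_rotate hac.symm hbc.symm hab]
    exact min_first (by omega) (by omega) hab

end

/-- The subgroup of `Sym(ℤ)` generated by the translation `t : n ↦ n + 1` together with
all 3-cycles equals the subgroup generated by the two elements `t` and `c = (-1 0 1)`.
In particular the alternating enrichment `𝒜(ℤ) = FAlt(ℤ) ⋊ ℤ` is 2-generated. -/
theorem closure_translation_threeCycles_eq_closure_pair :
    Subgroup.closure
        ({translation} ∪
          {σ : Equiv.Perm ℤ | ∃ a b c : ℤ,
            a ≠ b ∧ a ≠ c ∧ b ≠ c ∧ σ = threeCycle a b c}) =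
      Subgroup.closure {translation, threeCycle (-1) 0 1} := by
  apply le_antisymm
  · rw [Subgroup.closure_le]
    have ht : translation ∈ Subgroup.closure {translation, threeCycle (-1) 0 1} :=
      Subgroup.subset_closure (by simp)
    have hc : threeCycle (-1) 0 1 ∈ Subgroup.closure {translation, threeCycle (-1) 0 1} :=
      Subgroup.subset_closure (by simp)
    rintro σ (rfl | ⟨a, b, c, hab, hac, hbc, rfl⟩)
    · exact ht
    · exact threeCycle_mem (threeCycle_consecutive_mem ht hc) hab hac hbc
  · apply Subgroup.closure_mono
    rintro σ (rfl | rfl)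
    · exact Or.inl rfl
    · exact Or.inr ⟨-1, 0, 1, by decide, by decide, by decide, rfl⟩
end

section
/- Let F be the free group on two generators x₁, x₂; let π : F → Sym(ℤ) be the homomorphism with π(x₁) = t (the translation n ↦ n + 1) and π(x₂) = c = (−1 0 1), so that the image of π is the alternating enrichment 𝒜(ℤ). For an integer r ≥ 2, let ⟦r⟧ = {m ∈ ℤ : |m| ≤ r}, let α_r ∈ Sym(⟦r⟧) be the (2r+1)-cycle (−r, 1−r, …, r−1, r), let β_r = (−1 0 1) ∈ Sym(⟦r⟧), and let π_r : F → Sym(⟦r⟧) be the homomorphism with π_r(x₁) = α_r, π_r(x₂) = β_r. Then for every strictly increasing function r : ℕ → ℕ with r(n) ≥ 2 for all n, and for every K ∈ ℕ, there is N such that for all n ≥ N and every word w ∈ F of length at most K: π(w) = id if and only if π_{r(n)}(w) = id. (That is, the marked groups (Alt(⟦r(n)⟧), (α_{r(n)}, β_{r(n)})) converge to (𝒜(ℤ), (t, c)) in the space of marked 2-generated groups.) -/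
/-- The interval `⟦r⟧ = {m ∈ ℤ : |m| ≤ r}`. -/
abbrev IntBall (r : ℕ) : Type := {m : ℤ // |m| ≤ (r : ℤ)}

private def bcFun (r : ℕ) (x : IntBall r) : IntBall r :=
  if h : (x : ℤ) < (r : ℤ) then
    ⟨(x : ℤ) + 1, by have hx := abs_le.mp x.2; rw [abs_le]; omega⟩
  else ⟨-(r : ℤ), by rw [abs_le]; omega⟩

private def bcInv (r : ℕ) (x : IntBall r) : IntBall r :=
  if h : -(r : ℤ) < (x : ℤ) then
    ⟨(x : ℤ) - 1, by have hx := abs_le.mp x.2; rw [abs_le]; omega⟩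
  else ⟨(r : ℤ), by rw [abs_le]; omega⟩

private lemma bc_left (r : ℕ) : Function.LeftInverse (bcInv r) (bcFun r) := by
  rintro ⟨x, hx⟩
  have hx' := abs_le.mp hx
  simp only [bcFun, bcInv]
  split_ifs with h1 h2 h2 <;>
    (apply Subtype.ext;
      simp only [Subtype.coe_mk] at h2 ⊢; omega)

private lemma bc_right (r : ℕ) : Function.RightInverse (bcInv r) (bcFun r) := by
  rintro ⟨x, hx⟩
  have hx' := abs_le.mp hx
  simp only [bcFun, bcInv]
  split_ifs with h1 h2 h2 <;>
    (apply Subtype.ext;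
      simp only [Subtype.coe_mk] at h2 ⊢; omega)

/-- The `(2r+1)`-cycle `α_r = (-r, 1-r, …, r-1, r)` on `⟦r⟧`. -/
def bigCycle (r : ℕ) : Equiv.Perm (IntBall r) :=
  ⟨bcFun r, bcInv r, bc_left r, bc_right r⟩

/-- The 3-cycle `β_r = (-1 0 1)` on `⟦r⟧` (for `r ≥ 2`). -/
def smallCycle (r : ℕ) (hr : 2 ≤ r) : Equiv.Perm (IntBall r) :=
  Equiv.swap ⟨-1, by rw [abs_le]; omega⟩ ⟨1, by rw [abs_le]; omega⟩ *
    Equiv.swap ⟨-1, by rw [abs_le]; omega⟩ ⟨0, by rw [abs_le]; omega⟩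

/-- The marked homomorphism `π_r : F₂ → Sym(⟦r⟧)`, `x₁ ↦ α_r`, `x₂ ↦ β_r`. -/
def ballHom (r : ℕ) (hr : 2 ≤ r) : FreeGroup (Fin 2) →* Equiv.Perm (IntBall r) :=
  FreeGroup.lift ![bigCycle r, smallCycle r hr]

/-- The marked homomorphism `π : F₂ → Sym(ℤ)`, `x₁ ↦ t`, `x₂ ↦ c = (-1 0 1)`;
its image is the alternating enrichment `𝒜(ℤ)`. -/
def enrichHom : FreeGroup (Fin 2) →* Equiv.Perm ℤ :=
  FreeGroup.lift ![translation, threeCycle (-1) 0 1]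

lemma threeCycle_apply (y : ℤ) :
    threeCycle (-1) 0 1 y = if y = -1 then 0 else if y = 0 then 1 else if y = 1 then -1 else y := by
  simp only [threeCycle, Equiv.Perm.mul_apply, Equiv.swap_apply_def]
  grind

lemma threeCycle_inv_apply (y : ℤ) :
    (threeCycle (-1) 0 1)⁻¹ y =
      if y = 0 then -1 else if y = 1 then 0 else if y = -1 then 1 else y := by
  rw [Equiv.Perm.inv_eq_iff_eq, threeCycle_apply]
  grind

lemma coe_smallCycle_apply (r : ℕ) (hr : 2 ≤ r) (b : IntBall r) :
    (smallCycle r hr b : ℤ) = threeCycle (-1) 0 1 b := by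
  obtain ⟨b, hb⟩ := b
  simp only [smallCycle, threeCycle, Equiv.Perm.mul_apply, Equiv.swap_apply_def, Subtype.mk.injEq]
  split_ifs <;> simp_all

lemma coe_smallCycle_inv_apply (r : ℕ) (hr : 2 ≤ r) (b : IntBall r) :
    ((smallCycle r hr)⁻¹ b : ℤ) = (threeCycle (-1) 0 1)⁻¹ b := by
  rw [Equiv.Perm.eq_inv_iff_eq, ← coe_smallCycle_apply r hr]
  simp

lemma coe_bigCycle_apply (r : ℕ) (b : IntBall r) :
    (bigCycle r b : ℤ) = if (b : ℤ) < r then (b : ℤ) + 1 else -r := by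
  change ((bcFun r b : IntBall r) : ℤ) = _
  unfold bcFun
  split_ifs <;> rfl

lemma coe_bigCycle_inv_apply (r : ℕ) (b : IntBall r) :
    ((bigCycle r)⁻¹ b : ℤ) = if -(r : ℤ) < b then (b : ℤ) - 1 else r := by
  change ((bcInv r b : IntBall r) : ℤ) = _
  unfold bcInv
  split_ifs <;> rfl

lemma translation_apply (y : ℤ) : translation y = y + 1 := rfl

lemma translation_inv_apply (y : ℤ) : translation⁻¹ y = y - 1 := by
  rw [Equiv.Perm.inv_eq_iff_eq, translation_apply]
  omega

/-- The point `b` of the ball is the residue of `y` modulo `2r + 1`, for `y` at most one period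
away from the ball. -/
def IsResidue (r : ℕ) (b : IntBall r) (y : ℤ) : Prop :=
  (b : ℤ) = y ∨ (b : ℤ) = y + (2 * r + 1) ∨ (b : ℤ) = y - (2 * r + 1)

lemma enrichHom_mk_cons (a : Fin 2 × Bool) (L : List (Fin 2 × Bool)) (x : ℤ) :
    enrichHom (FreeGroup.mk (a :: L)) x =
      enrichHom (FreeGroup.mk [a]) (enrichHom (FreeGroup.mk L) x) := by
  rw [← Equiv.Perm.mul_apply, ← map_mul, FreeGroup.mul_mk, List.singleton_append]

lemma ballHom_mk_cons (r : ℕ) (hr : 2 ≤ r) (a : Fin 2 × Bool) (L : List (Fin 2 × Bool))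
    (x : IntBall r) :
    ballHom r hr (FreeGroup.mk (a :: L)) x =
      ballHom r hr (FreeGroup.mk [a]) (ballHom r hr (FreeGroup.mk L) x) := by
  rw [← Equiv.Perm.mul_apply, ← map_mul, FreeGroup.mul_mk, List.singleton_append]

lemma abs_enrichHom_letter_sub_le (a : Fin 2 × Bool) (y : ℤ) :
    |enrichHom (FreeGroup.mk [a]) y - y| ≤ 2 := by
  obtain ⟨i, s⟩ := a
  rw [abs_le]
  fin_cases i <;> cases s <;>
    simp [enrichHom, translation_apply, translation_inv_apply, threeCycle_apply,
      threeCycle_inv_apply, -Int.reduceNeg] <;> (try split_ifs) <;> omega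

lemma exists_enrichHom_letter_eq_add (a : Fin 2 × Bool) :
    ∃ d : ℤ, ∀ y : ℤ, 2 ≤ |y| → enrichHom (FreeGroup.mk [a]) y = y + d := by
  obtain ⟨i, s⟩ := a
  refine ⟨if i = 0 then (if s then 1 else -1) else 0, fun y hy => ?_⟩
  rw [le_abs] at hy
  fin_cases i <;> cases s <;>
    simp [enrichHom, translation_apply, translation_inv_apply, threeCycle_apply,
      threeCycle_inv_apply, -Int.reduceNeg] <;> (try split_ifs) <;> omega

lemma IsResidue.letter {r : ℕ} (hr : 2 ≤ r) (a : Fin 2 × Bool) {b : IntBall r} {y : ℤ}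
    (h : IsResidue r b y) (hy : |y| ≤ 2 * r - 2) :
    IsResidue r (ballHom r hr (FreeGroup.mk [a]) b) (enrichHom (FreeGroup.mk [a]) y) := by
  obtain ⟨i, s⟩ := a
  have hb := abs_le.mp b.2
  rw [abs_le] at hy
  unfold IsResidue at h ⊢
  fin_cases i <;> cases s <;>
    simp [enrichHom, ballHom, translation_apply, translation_inv_apply, threeCycle_apply,
      threeCycle_inv_apply, coe_smallCycle_apply, coe_smallCycle_inv_apply, coe_bigCycle_apply,
      coe_bigCycle_inv_apply, -Int.reduceNeg, -Equiv.Perm.coe_inv] <;> (try split_ifs) <;> omega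

lemma abs_enrichHom_mk_sub_le (L : List (Fin 2 × Bool)) (x : ℤ) :
    |enrichHom (FreeGroup.mk L) x - x| ≤ 2 * L.length := by
  induction L with
  | nil => simp [← FreeGroup.one_eq_mk]
  | cons a L ih =>
    have h := abs_enrichHom_letter_sub_le a (enrichHom (FreeGroup.mk L) x)
    rw [enrichHom_mk_cons, List.length_cons]
    rw [abs_le] at *
    push_cast
    omega

lemma exists_enrichHom_mk_eq_add (L : List (Fin 2 × Bool)) :
    ∃ d : ℤ, ∀ x : ℤ, 2 * (L.length : ℤ) + 2 ≤ |x| → enrichHom (FreeGroup.mk L) x = x + d := by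
  induction L with
  | nil => exact ⟨0, by simp [← FreeGroup.one_eq_mk]⟩
  | cons a L ih =>
    obtain ⟨d, hd⟩ := ih
    obtain ⟨e, he⟩ := exists_enrichHom_letter_eq_add a
    refine ⟨d + e, fun x hx => ?_⟩
    rw [List.length_cons] at hx
    push_cast at hx
    have h := abs_enrichHom_mk_sub_le L x
    rw [enrichHom_mk_cons, he, hd x (by omega), add_assoc]
    rw [abs_le] at h
    rw [le_abs] at *
    omega

lemma IsResidue.word {r : ℕ} (hr : 2 ≤ r) (L : List (Fin 2 × Bool)) {b : IntBall r} {x : ℤ}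
    (h : IsResidue r b x) (hx : |x| + 2 * L.length ≤ 2 * r) :
    IsResidue r (ballHom r hr (FreeGroup.mk L) b) (enrichHom (FreeGroup.mk L) x) := by
  induction L with
  | nil => simpa [← FreeGroup.one_eq_mk] using h
  | cons a L ih =>
    rw [List.length_cons] at hx
    push_cast at hx
    rw [enrichHom_mk_cons, ballHom_mk_cons]
    refine (ih (by omega)).letter hr a ?_
    have h1 := abs_enrichHom_mk_sub_le L x
    have h2 := abs_add_le (enrichHom (FreeGroup.mk L) x - x) x
    rw [sub_add_cancel] at h2
    omega

/-- In a ball of radius at least `2 * L.length + 2`, the word `L` is a relation of the marked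
group on the ball iff it is a relation of the alternating enrichment. -/
lemma enrichHom_mk_eq_one_iff {r : ℕ} (hr : 2 ≤ r) (L : List (Fin 2 × Bool))
    (hL : 2 * L.length + 2 ≤ r) :
    enrichHom (FreeGroup.mk L) = 1 ↔ ballHom r hr (FreeGroup.mk L) = 1 := by
  have key (b : IntBall r) :=
    IsResidue.word hr L (b := b) (x := b) (Or.inl rfl) (by have := b.2; omega)
  constructor
  · intro h
    ext b
    have hk := key b
    have h1 := abs_le.mp b.2
    have h2 := abs_le.mp (ballHom r hr (FreeGroup.mk L) b).2
    rw [h] at hk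
    simp only [IsResidue, Equiv.Perm.one_apply] at hk ⊢
    omega
  · intro h
    have inner (x : ℤ) (hx : |x| ≤ r) : enrichHom (FreeGroup.mk L) x = x := by
      have hk := key ⟨x, hx⟩
      have h1 := abs_le.mp (abs_enrichHom_mk_sub_le L x)
      rw [h] at hk
      simp only [IsResidue, Equiv.Perm.one_apply] at hk
      omega
    obtain ⟨d, hd⟩ := exists_enrichHom_mk_eq_add L
    have hr' : |(r : ℤ)| = r := abs_of_nonneg (by omega)
    have h0 := inner r hr'.le
    rw [hd r (by omega)] at h0
    ext x
    rw [Equiv.Perm.one_apply]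
    by_cases hx : |x| ≤ r
    · exact inner x hx
    · rw [hd x (by omega)]
      omega

/-- The marked finite alternating groups `(Alt(⟦r(n)⟧), (α_{r(n)}, β_{r(n)}))` converge to
`(𝒜(ℤ), (t, c))` in the space of marked 2-generated groups: for every strictly
increasing `r : ℕ → ℕ` with `r(n) ≥ 2` and every `K`, for all large `n` a word `w` of
length at most `K` is a relation of the one marking iff it is a relation of the other. -/
theorem marked_alternating_converge (r : ℕ → ℕ) (hmono : StrictMono r)
    (hr : ∀ n, 2 ≤ r n) (K : ℕ) :
    ∃ N : ℕ, ∀ n ≥ N, ∀ w : FreeGroup (Fin 2), w.toWord.length ≤ K →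
      (enrichHom w = 1 ↔ ballHom (r n) (hr n) w = 1) := by
  refine ⟨2 * K + 2, fun n hn w hw => ?_⟩
  have h := hmono.le_apply (x := n)
  rw [← FreeGroup.mk_toWord (x := w)]
  exact enrichHom_mk_eq_one_iff (hr n) _ (by omega)
end
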